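/- Let x, y ∈ ℤ_{-τ} be consecutive (-τ)-integers with x < y (no element of ℤ_{-τ} lies strictly between x and y) and y - x = 1. Then [τ²·x, τ²·y] ∩ ℤ_{-τ} = {τ²·x, τ²·x + 1, τ²·x + 2, τ²·x + 2 + 1/τ}, where τ²·y = τ²·x + 2 + 1/τ. -/

import Mathlib

/-- The Ito–Sadahiro transformation `T_{-β}` on `[l_β, r_β)`, where
`l_β = -β/(β+1)` and `r_β = 1/(β+1)`. -/
noncomputable def negT (β : ℝ) (x : ℝ) : ℝ :=
  -β * x - (⌊-β * x - (-β / (β + 1))⌋ : ℝ)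

/-- `Fin(-β)`: reals `x` such that `(-β)^k * x ∈ (l_β, r_β)` for some `k : ℤ`
and some iterate of `T_{-β}` sends it to `0`. -/
def negFin (β : ℝ) (x : ℝ) : Prop :=
  ∃ (k : ℤ) (n : ℕ), ((-β) ^ k * x ∈ Set.Ioo (-β / (β + 1)) (1 / (β + 1))) ∧
    (negT β)^[n] ((-β) ^ k * x) = 0

/-- The set `ℤ_{-β}` of `(-β)`-integers. -/
def negInt (β : ℝ) (x : ℝ) : Prop :=
  x = 0 ∨ ∃ (N : ℕ) (y : ℝ), y ∈ Set.Ioo (-β / (β + 1)) (1 / (β + 1)) ∧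
    x = (-β) ^ (N + 1) * y ∧ (negT β)^[N + 1] y = 0

/-- The `(-β)`-digit `d_{i+1}(y)` of `y ∈ [l_β, r_β)` (indices shifted so that
`negDigit β y i` is the digit `d_{i+1}(y)`). -/
noncomputable def negDigit (β : ℝ) (y : ℝ) (i : ℕ) : ℤ :=
  ⌊-β * ((negT β)^[i] y) - (-β / (β + 1))⌋

/-- The golden ratio `τ = (1+√5)/2`. -/
noncomputable def tau : ℝ := (1 + Real.sqrt 5) / 2

/-- The Rényi transformation `T_β` on `[0,1)`. -/
noncomputable def renyiT (β : ℝ) (x : ℝ) : ℝ := β * x - (⌊β * x⌋ : ℝ)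

/-- The set `ℤ_β` of (nonnegative) `β`-integers. -/
def posInt (β : ℝ) (x : ℝ) : Prop :=
  x = 0 ∨ ∃ N : ℕ, (β ^ (-(N + 1 : ℤ)) * x ∈ Set.Ico (0 : ℝ) 1) ∧
    (renyiT β)^[N + 1] (β ^ (-(N + 1 : ℤ)) * x) = 0

lemma tau_sq_eq : tau ^ 2 = tau + 1 := by
  have h : Real.sqrt 5 ^ 2 = 5 := Real.sq_sqrt (by norm_num)
  unfold tau
  linear_combination h / 4

lemma tau_gt : 1.618 < tau := by
  have h : 2.236 < Real.sqrt 5 := Real.lt_sqrt_of_sq_lt (by norm_num)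
  unfold tau
  linarith

lemma tau_lt : tau < 1.6185 := by
  have h : Real.sqrt 5 < 2.237 := (Real.sqrt_lt' (by norm_num)).2 (by norm_num)
  unfold tau
  linarith

lemma one_div_tau : 1 / tau = tau - 1 := by
  rw [div_eq_iff (by linarith [tau_gt])]
  linear_combination -tau_sq_eq

lemma left_endpoint_tau : -tau / (tau + 1) = 1 - tau := by
  rw [div_eq_iff (by linarith [tau_gt])]
  linear_combination tau_sq_eq

lemma right_endpoint_tau : 1 / (tau + 1) = 2 - tau := by
  rw [div_eq_iff (by linarith [tau_gt])]
  linear_combination tau_sq_eq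

/-- The points `a + bτ` of `ℤ[τ]` whose Galois conjugate `a + b(1 - τ)` lies in `[0, τ²)`. -/
def tauModelSet (w : ℝ) : Prop :=
  ∃ a b : ℤ, w = a + b * tau ∧ 0 ≤ a + b * (1 - tau) ∧ a + b * (1 - tau) < tau + 1

lemma negT_tau_step {u : ℝ} (hu : u ∈ Set.Ico (1 - tau) (2 - tau)) :
    ∃ d : ℤ, (d = 0 ∨ d = 1) ∧ negT tau u = -tau * u - d ∧
      negT tau u ∈ Set.Ico (1 - tau) (2 - tau) := by
  have h1 := tau_gt
  have h2 := tau_lt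
  have h3 := tau_sq_eq
  obtain ⟨hl, hr⟩ := hu
  have hlo : 0 < -tau * u - (1 - tau) := by nlinarith
  have hhi : -tau * u - (1 - tau) < 2 := by nlinarith
  have hT : negT tau u = -tau * u - (⌊-tau * u - (1 - tau)⌋ : ℝ) := by
    rw [negT, left_endpoint_tau]
  have hf1 := Int.floor_le (-tau * u - (1 - tau))
  have hf2 := Int.lt_floor_add_one (-tau * u - (1 - tau))
  refine ⟨⌊-tau * u - (1 - tau)⌋, ?_, hT, ?_, ?_⟩
  · have h0 : 0 ≤ ⌊-tau * u - (1 - tau)⌋ := Int.floor_nonneg.2 hlo.le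
    have h2 : ⌊-tau * u - (1 - tau)⌋ < 2 := Int.floor_lt.2 (by exact_mod_cast hhi)
    omega
  · rw [hT]; linarith
  · rw [hT]; linarith

lemma conj_bounds_step {c : ℝ} {d : ℤ} (hd : d = 0 ∨ d = 1) (h0 : 0 ≤ c) (h1 : c < tau + 1) :
    0 ≤ d + c * (tau - 1) ∧ d + c * (tau - 1) < tau + 1 := by
  have := tau_gt
  have := tau_sq_eq
  rcases hd with rfl | rfl <;> push_cast <;> constructor <;> nlinarith

lemma negT_tau_iterate {u : ℝ} (hu : u ∈ Set.Ico (1 - tau) (2 - tau)) (n : ℕ) :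
    (negT tau)^[n] u ∈ Set.Ico (1 - tau) (2 - tau) ∧
      ∃ a b : ℤ, (negT tau)^[n] u = (-tau) ^ n * u - (a + b * tau) ∧
        0 ≤ a + b * (1 - tau) ∧ a + b * (1 - tau) < tau + 1 := by
  induction n with
  | zero =>
    refine ⟨hu, 0, 0, by simp, by simp, ?_⟩
    have := tau_gt
    push_cast
    linarith
  | succ n ih =>
    obtain ⟨hI, a, b, hab, h0, h1⟩ := ih
    obtain ⟨d, hd, hT, hTI⟩ := negT_tau_step hI
    rw [Function.iterate_succ_apply']
    obtain ⟨hc0, hc1⟩ := conj_bounds_step hd h0 h1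
    have hc : ((d - b : ℤ) : ℝ) + ((-a - b : ℤ) : ℝ) * (1 - tau)
        = d + (a + b * (1 - tau)) * (tau - 1) := by
      push_cast
      linear_combination (b : ℝ) * tau_sq_eq
    refine ⟨hTI, d - b, -a - b, ?_, hc ▸ hc0, hc ▸ hc1⟩
    rw [hT, hab]
    push_cast
    linear_combination (b : ℝ) * tau_sq_eq

lemma tauModelSet_of_negInt {w : ℝ} (hw : negInt tau w) : tauModelSet w := by
  rcases hw with rfl | ⟨N, y, hy, rfl, hT⟩
  · refine ⟨0, 0, by simp, by simp, ?_⟩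
    have := tau_gt
    push_cast
    linarith
  · rw [left_endpoint_tau, right_endpoint_tau] at hy
    obtain ⟨-, a, b, hab, h⟩ := negT_tau_iterate (Set.Ioo_subset_Ico_self hy) (N + 1)
    exact ⟨a, b, by linarith, h⟩

/-- Bounding `B` by comparing `A + Bτ` with its conjugate: their difference is `B√5`. -/
lemma abs_coeff_le_one {B : ℤ} (h1 : -4.4 < B * (2 * tau - 1)) (h2 : B * (2 * tau - 1) < 4.4) :
    B = -1 ∨ B = 0 ∨ B = 1 := by
  have := tau_gt
  have hB1 : B < 2 := by
    by_contra! h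
    have h' : (2 : ℝ) ≤ B := by exact_mod_cast h
    nlinarith
  have hB2 : -2 < B := by
    by_contra! h
    have h' : (B : ℝ) ≤ -2 := by exact_mod_cast h
    nlinarith
  omega

lemma eq_zero_or_left_endpoint {A B : ℤ}
    (hI : (A + B * tau : ℝ) ∈ Set.Ico (1 - tau) (2 - tau))
    (h1 : -(tau + 1) < A + B * (1 - tau)) (h2 : A + B * (1 - tau) < tau + 1) :
    (A = 0 ∧ B = 0) ∨ (A = 1 ∧ B = -1) := by
  have ht := tau_gt
  have ht' := tau_lt
  obtain ⟨hl, hr⟩ := hI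
  rcases abs_coeff_le_one (B := B) (by linarith) (by linarith) with rfl | rfl | rfl
  all_goals push_cast at hl hr h1 h2
  · have ha : A < 2 := by
      have : (A : ℝ) < 2 := by linarith
      exact_mod_cast this
    have hb : 0 < A := by
      have : (0 : ℝ) < A := by linarith
      exact_mod_cast this
    omega
  · have ha : A < 1 := by
      have : (A : ℝ) < 1 := by linarith
      exact_mod_cast this
    have hb : -1 < A := by
      have : (-1 : ℝ) < A := by linarith
      exact_mod_cast this
    omega
  · exfalso
    have ha : A < -1 := by
      have : (A : ℝ) < -1 := by linarith
      exact_mod_cast this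
    have hb : -2 < A := by
      have : (-2 : ℝ) < A := by linarith
      exact_mod_cast this
    omega

lemma exists_scaled_mem_Ioo (w : ℝ) :
    ∃ (N : ℕ) (y : ℝ), y ∈ Set.Ioo (1 - tau) (2 - tau) ∧ w = (-tau) ^ (N + 1) * y := by
  have ht := tau_gt
  have ht' := tau_lt
  obtain ⟨n, hn⟩ := pow_unbounded_of_one_lt (4 * |w|) (show 1 < tau by linarith)
  have hpos : 0 < tau ^ (n + 1) := by positivity
  have hn' : 4 * |w| < tau ^ (n + 1) :=
    hn.trans_le (pow_le_pow_right₀ (by linarith) n.le_succ)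
  have hne : (-tau) ^ (n + 1) ≠ 0 := pow_ne_zero _ (by linarith)
  refine ⟨n, w / (-tau) ^ (n + 1), ?_, (mul_div_cancel₀ w hne).symm⟩
  have habs : |w / (-tau) ^ (n + 1)| < 1 / 4 := by
    rw [abs_div, abs_pow, abs_neg, abs_of_pos (by linarith : 0 < tau), div_lt_iff₀ hpos]
    linarith
  obtain ⟨h1, h2⟩ := abs_lt.1 habs
  constructor <;> linarith

lemma negInt_of_tauModelSet {w : ℝ} (hw : tauModelSet w) : negInt tau w := by
  have ht := tau_gt
  have hsq := tau_sq_eq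
  obtain ⟨a, b, hab, hc0, hc1⟩ := hw
  obtain ⟨N, y, hy, hwy⟩ := exists_scaled_mem_Ioo w
  refine Or.inr ⟨N, y, by rwa [left_endpoint_tau, right_endpoint_tau], hwy, ?_⟩
  obtain ⟨hI, p, q, hpq, hp0, hp1⟩ := negT_tau_iterate (Set.Ioo_subset_Ico_self hy) N
  obtain ⟨d, hd, hT, hTI⟩ := negT_tau_step hI
  obtain ⟨he0, he1⟩ := conj_bounds_step hd hp0 hp1
  have hval : negT tau ((negT tau)^[N] y)
      = ((a - (d - q) : ℤ) : ℝ) + ((b - (-p - q) : ℤ) : ℝ) * tau := by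
    rw [hT, hpq]
    push_cast
    linear_combination hab - hwy + (q : ℝ) * hsq
  have hconj : ((a - (d - q) : ℤ) : ℝ) + ((b - (-p - q) : ℤ) : ℝ) * (1 - tau)
      = (a + b * (1 - tau)) - (d + (p + q * (1 - tau)) * (tau - 1)) := by
    push_cast
    linear_combination -(q : ℝ) * hsq
  rw [Function.iterate_succ_apply']
  rcases eq_zero_or_left_endpoint (hval ▸ hTI) (by rw [hconj]; linarith)
    (by rw [hconj]; linarith) with ⟨hA, hB⟩ | ⟨hA, hB⟩
  · rw [hval, hA, hB]; simp
  · exfalso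
    rw [hA, hB] at hval hconj
    rcases hd with rfl | rfl
    · have hr := hI.2
      rw [hT] at hval
      push_cast at hval
      nlinarith
    · push_cast at hconj
      nlinarith [mul_nonneg hp0 (by linarith : 0 ≤ tau - 1)]

/-- The `(-τ)`-integers form the model set with window `[0, τ²)`. -/
lemma negInt_tau_iff (w : ℝ) : negInt tau w ↔ tauModelSet w :=
  ⟨tauModelSet_of_negInt, negInt_of_tauModelSet⟩

/-- A model-set point with conjugate below `τ` has no other model-set point within distance
less than `1` to its right. -/
lemma not_tauModelSet_of_lt_one {a b : ℤ} {w : ℝ} (h0 : 0 ≤ a + b * (1 - tau))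
    (h1 : a + b * (1 - tau) < tau) (hlo : a + b * tau < w) (hhi : w < a + b * tau + 1) :
    ¬ tauModelSet w := by
  rintro ⟨p, q, rfl, hc0, hc1⟩
  have ht := tau_gt
  have ht' := tau_lt
  obtain ⟨A, rfl⟩ : ∃ A, p = a + A := ⟨p - a, by ring⟩
  obtain ⟨B, rfl⟩ : ∃ B, q = b + B := ⟨q - b, by ring⟩
  push_cast at *
  rcases abs_coeff_le_one (B := B) (by linarith) (by linarith) with rfl | rfl | rfl
  all_goals push_cast at *
  · have ha : A < 2 := by
      have : (A : ℝ) < 2 := by linarith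
      exact_mod_cast this
    have hb : 1 < A := by
      have : (1 : ℝ) < A := by linarith
      exact_mod_cast this
    omega
  · have ha : A < 1 := by
      have : (A : ℝ) < 1 := by linarith
      exact_mod_cast this
    have hb : 0 < A := by
      have : (0 : ℝ) < A := by linarith
      exact_mod_cast this
    omega
  · have ha : A < 0 := by
      have : (A : ℝ) < 0 := by linarith
      exact_mod_cast this
    have hb : -1 < A := by
      have : (-1 : ℝ) < A := by linarith
      exact_mod_cast this
    omega

/-- A model-set point with conjugate at least `τ` has no other model-set point within distance
less than `1/τ` to its right. -/
lemma not_tauModelSet_of_lt_inv {a b : ℤ} {w : ℝ} (h0 : tau ≤ a + b * (1 - tau))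
    (h1 : a + b * (1 - tau) < tau + 1) (hlo : a + b * tau < w)
    (hhi : w < a + b * tau + (tau - 1)) :
    ¬ tauModelSet w := by
  rintro ⟨p, q, rfl, hc0, hc1⟩
  have ht := tau_gt
  have ht' := tau_lt
  obtain ⟨A, rfl⟩ : ∃ A, p = a + A := ⟨p - a, by ring⟩
  obtain ⟨B, rfl⟩ : ∃ B, q = b + B := ⟨q - b, by ring⟩
  push_cast at *
  rcases abs_coeff_le_one (B := B) (by linarith) (by linarith) with rfl | rfl | rfl
  all_goals push_cast at *
  · linarith
  · have ha : A < 1 := by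
      have : (A : ℝ) < 1 := by linarith
      exact_mod_cast this
    have hb : 0 < A := by
      have : (0 : ℝ) < A := by linarith
      exact_mod_cast this
    omega
  · have ha : A < -1 := by
      have : (A : ℝ) < -1 := by linarith
      exact_mod_cast this
    have hb : -2 < A := by
      have : (-2 : ℝ) < A := by linarith
      exact_mod_cast this
    omega

/-- If `x < y` are consecutive `(-τ)`-integers at distance `1`, then
`[τ²x, τ²y] ∩ ℤ_{-τ} = {τ²x, τ²x + 1, τ²x + 2, τ²x + 2 + 1/τ}` with
`τ²y = τ²x + 2 + 1/τ`. -/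
theorem tau_sq_image_of_gap_one
    (x y : ℝ) (hx : negInt tau x) (hy : negInt tau y) (hxy : x < y)
    (hcons : ∀ w : ℝ, negInt tau w → w ∉ Set.Ioo x y) (hgap : y - x = 1) :
    Set.Icc (tau ^ 2 * x) (tau ^ 2 * y) ∩ {w : ℝ | negInt tau w}
        = {tau ^ 2 * x, tau ^ 2 * x + 1, tau ^ 2 * x + 2, tau ^ 2 * x + 2 + 1 / tau} ∧
      tau ^ 2 * y = tau ^ 2 * x + 2 + 1 / tau := by
  have ht := tau_gt
  have ht' := tau_lt
  have hsq := tau_sq_eq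
  obtain ⟨a, b, rfl, hc0, hc1⟩ := (negInt_tau_iff _).1 hx
  obtain rfl : y = a + b * tau + 1 := by linarith
  have hctau : (a + b * (1 - tau) : ℝ) < tau := by
    by_contra! h
    refine hcons (a + b * tau + (tau - 1)) ((negInt_tau_iff _).2 ⟨a - 1, b + 1, ?_, ?_, ?_⟩)
      ⟨by linarith, by linarith⟩ <;> push_cast <;> linarith
  obtain ⟨p, q, hs, hp0, hp1⟩ : ∃ p q : ℤ, tau ^ 2 * (a + b * tau) = p + q * tau ∧
      0 ≤ p + q * (1 - tau) ∧ p + q * (1 - tau) < tau - 1 := by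
    have hconj : ((a + b : ℤ) : ℝ) + ((a + 2 * b : ℤ) : ℝ) * (1 - tau)
        = (a + b * (1 - tau)) * (2 - tau) := by
      push_cast
      linear_combination -(b : ℝ) * hsq
    refine ⟨a + b, a + 2 * b, ?_, ?_, ?_⟩
    · push_cast
      linear_combination (a + b * tau + b : ℝ) * hsq
    · rw [hconj]; nlinarith
    · rw [hconj]; nlinarith
  have hend : tau ^ 2 * (a + b * tau + 1) = tau ^ 2 * (a + b * tau) + 2 + 1 / tau := by
    rw [one_div_tau]
    linear_combination hsq
  refine ⟨?_, hend⟩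
  rw [hend, one_div_tau, hs]
  ext w
  simp only [Set.mem_inter_iff, Set.mem_Icc, Set.mem_ofPred_eq, Set.mem_insert_iff,
    Set.mem_singleton_iff, negInt_tau_iff]
  constructor
  · rintro ⟨⟨hlo, hhi⟩, hw⟩
    by_contra! hne
    obtain ⟨n0, n1, n2, n3⟩ := hne
    have hlo' := lt_of_le_of_ne hlo (Ne.symm n0)
    have hhi' := lt_of_le_of_ne hhi n3
    rcases lt_or_gt_of_ne n1 with l1 | g1
    · exact not_tauModelSet_of_lt_one hp0 (by linarith) hlo' l1 hw
    rcases lt_or_gt_of_ne n2 with l2 | g2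
    · refine not_tauModelSet_of_lt_one (a := p + 1) (b := q) ?_ ?_ ?_ ?_ hw <;>
        push_cast <;> linarith
    · refine not_tauModelSet_of_lt_inv (a := p + 2) (b := q) ?_ ?_ ?_ ?_ hw <;>
        push_cast <;> linarith
  · rintro (rfl | rfl | rfl | rfl)
    · exact ⟨⟨by linarith, by linarith⟩, p, q, rfl, hp0, by linarith⟩
    · exact ⟨⟨by linarith, by linarith⟩, p + 1, q, by push_cast; ring,
        by push_cast; linarith, by push_cast; linarith⟩
    · exact ⟨⟨by linarith, by linarith⟩, p + 2, q, by push_cast; ring,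
        by push_cast; linarith, by push_cast; linarith⟩
    · exact ⟨⟨by linarith, by linarith⟩, p + 1, q + 1, by push_cast; ring,
        by push_cast; linarith, by push_cast; linarith⟩
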